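/- Suppose f ∈ Homeo₀(T²) has an ε-upper-stable rotation set (in Homeo₀(T²)) with 0 < ε < 1, and let f̃ be a lift of f. Then for every x̃ ∈ ℝ² and every n ∈ ℕ, d(f̃ⁿ(x̃) − x̃, n·ρ(f̃)) ≤ (4/(πε²))·(osc(f) + 1) + ε, where n·ρ(f̃) = {n v : v ∈ ρ(f̃)}. -/

import Mathlib

noncomputable section

open Metric Set Filter Topology MeasureTheory Pointwise

/-- The plane `ℝ²` with the Euclidean metric. -/
abbrev R2 : Type := EuclideanSpace ℝ (Fin 2)

/-- The integer lattice `ℤ² ⊂ ℝ²`. -/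
def intLattice : AddSubgroup R2 where
  carrier := {v : R2 | ∀ i, ∃ n : ℤ, v i = (n : ℝ)}
  add_mem' := by
    intro a b ha hb i
    obtain ⟨m, hm⟩ := ha i
    obtain ⟨n, hn⟩ := hb i
    exact ⟨m + n, by push_cast; rw [← hm, ← hn]; rfl⟩
  zero_mem' := fun i => ⟨0, by simp⟩
  neg_mem' := by
    intro a ha i
    obtain ⟨m, hm⟩ := ha i
    exact ⟨-m, by push_cast; rw [← hm]; rfl⟩

/-- The torus `T² = ℝ²/ℤ²`, with the quotient (Euclidean) metric. -/
abbrev T2 : Type := R2 ⧸ intLattice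

/-- The covering projection `π : ℝ² → T²`. -/
def pr : R2 → T2 := QuotientAddGroup.mk

instance : MeasurableSpace T2 := borel T2
instance : BorelSpace T2 := ⟨rfl⟩

/-- A fundamental domain `[0,1)²` for the lattice action. -/
def fundDomain : Set R2 := {x : R2 | ∀ i, x i ∈ Set.Ico (0 : ℝ) 1}

/-- Lebesgue (Haar) probability measure on the torus `T²`. -/
def lebT2 : Measure T2 := Measure.map pr (volume.restrict fundDomain)

/-- `F : ℝ² → ℝ²` is a lift of `f : T² → T²` if `π ∘ F = f ∘ π` and
`F (x + w) = F x + w` for every lattice vector `w ∈ ℤ²`. -/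
structure IsLift (f : T2 ≃ₜ T2) (F : R2 ≃ₜ R2) : Prop where
  proj : ∀ x : R2, pr (F x) = f (pr x)
  equivariant : ∀ x : R2, ∀ w ∈ intLattice, F (x + w) = F x + w

/-- `Homeo₀(T²)`: homeomorphisms of the torus isotopic to the identity,
characterized as those admitting a lift commuting with integer translations. -/
def Homeo0 : Set (T2 ≃ₜ T2) := {f | ∃ F : R2 ≃ₜ R2, IsLift f F}

/-- `Homeo_{0,λ}(T²)`: elements of `Homeo₀(T²)` preserving Lebesgue measure. -/
def Homeo0Leb : Set (T2 ≃ₜ T2) :=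
  {f | f ∈ Homeo0 ∧ MeasurePreserving f lebT2 lebT2}

/-- The uniform `C⁰` distance `d_{C⁰}(f,g) = sup_x d(f(x), g(x))` on torus maps. -/
def dC0 (f g : T2 ≃ₜ T2) : ℝ := ⨆ x : T2, dist (f x) (g x)

/-- The uniform distance `sup_{x ∈ ℝ²} ‖F(x) − G(x)‖` between maps of the plane. -/
def supDist (F G : R2 → R2) : ℝ := ⨆ x : R2, dist (F x) (G x)

/-- The rotation set `ρ(F̃)` of a lift: all limits `(F̃^{n_k}(z_k) − z_k)/n_k`. -/
def rotSet (F : R2 ≃ₜ R2) : Set R2 :=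
  {v | ∃ (z : ℕ → R2) (n : ℕ → ℕ), Tendsto n atTop atTop ∧
    Tendsto (fun k => (n k : ℝ)⁻¹ • ((⇑F)^[n k] (z k) - z k)) atTop (𝓝 v)}

/-- The rotation set of `f`, with fixed lift `F`, is `δ`-upper-stable in `H`. -/
def UpperStable (H : Set (T2 ≃ₜ T2)) (F : R2 ≃ₜ R2) (δ : ℝ) : Prop :=
  ∀ g ∈ H, ∀ G : R2 ≃ₜ R2, IsLift g G → supDist (⇑F) (⇑G) < δ →
    rotSet G ⊆ rotSet F

/-- The rotation set of `f`, with fixed lift `F`, is `δ`-stable in `H`. -/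
def StableRS (H : Set (T2 ≃ₜ T2)) (F : R2 ≃ₜ R2) (δ : ℝ) : Prop :=
  ∀ g ∈ H, ∀ G : R2 ≃ₜ R2, IsLift g G → supDist (⇑F) (⇑G) < δ →
    rotSet G = rotSet F

/-- `f` has a stable rotation set in `H`. -/
def HasStableRotSet (H : Set (T2 ≃ₜ T2)) (f : T2 ≃ₜ T2) : Prop :=
  ∃ F : R2 ≃ₜ R2, IsLift f F ∧ ∃ δ > 0, StableRS H F δ

/-- `S` is open in `H` for the uniform `C⁰` topology. -/
def OpenIn (H S : Set (T2 ≃ₜ T2)) : Prop :=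
  ∀ f ∈ S ∩ H, ∃ δ > 0, ∀ g ∈ H, dC0 f g < δ → g ∈ S

/-- `S` is dense in `H` for the uniform `C⁰` topology. -/
def DenseIn (H S : Set (T2 ≃ₜ T2)) : Prop :=
  ∀ f ∈ H, ∀ ε > 0, ∃ g ∈ S ∩ H, dC0 f g < ε

/-- `(x_i)_{0 ≤ i ≤ n}` is a finite `ε`-pseudo-orbit of `F`. -/
def IsPseudoOrbitUpTo (F : R2 → R2) (ε : ℝ) (x : ℕ → R2) (n : ℕ) : Prop :=
  ∀ i < n, dist (F (x i)) (x (i + 1)) < ε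

/-- `(x_i)_{i ∈ ℕ}` is an infinite `ε`-pseudo-orbit of `F`. -/
def IsPseudoOrbit (F : R2 → R2) (ε : ℝ) (x : ℕ → R2) : Prop :=
  ∀ i : ℕ, dist (F (x i)) (x (i + 1)) < ε

/-- The `ε`-pseudo-rotation set `ρ_ε(F̃)`. -/
def pseudoRotSet (F : R2 → R2) (ε : ℝ) : Set R2 :=
  {v | ∃ (n : ℕ → ℕ) (x : ℕ → ℕ → R2), Tendsto n atTop atTop ∧
    (∀ k, IsPseudoOrbitUpTo F ε (x k) (n k)) ∧
    Tendsto (fun k => (n k : ℝ)⁻¹ • (x k (n k) - x k 0)) atTop (𝓝 v)}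

/-- The oscillation `osc(f) = sup_{x,y} ‖(F(x) − x) − (F(y) − y)‖` of a lift. -/
def osc (F : R2 → R2) : ℝ := ⨆ p : R2 × R2, ‖(F p.1 - p.1) - (F p.2 - p.2)‖

/-- `f` has the shadowing property. -/
def Shadowing (f : T2 ≃ₜ T2) : Prop :=
  ∀ ε > 0, ∃ δ > 0, ∀ x : ℕ → T2, (∀ i, dist (f (x i)) (x (i + 1)) < δ) →
    ∃ z : T2, ∀ i, dist ((⇑f)^[i] z) (x i) < ε

/-- `v ∈ ℚ² ⊂ ℝ²`. -/
def IsRationalPoint (v : R2) : Prop := ∀ i, ∃ q : ℚ, v i = (q : ℝ)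


theorem cross_lemma (β : ℝ → ℂ) (hβ : Continuous β) (w : ℂ)
    (hw : ∀ s t, β s - β t ≠ w) :
    ∃ t, ‖β t - (β 0 + β 1) / 2‖ ≤ ‖(β 0 - β 1) / 2 - w‖ := by
  by_contra! hcon
  obtain ⟨θ, ⟨-, hθ⟩, -⟩ := Complex.isCoveringMapOn_exp.existsUnique_continuousMap_lifts
    (A := ℝ × ℝ) ⟨fun p => β p.1 - β p.2 - w, by fun_prop⟩ (a₀ := (0, 0))
    (e₀ := Complex.log (β 0 - β 0 - w)) (Complex.exp_log (sub_ne_zero.2 (hw 0 0)))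
    (fun p => sub_ne_zero.2 (hw p.1 p.2))
  have hθ' : ∀ s t, Complex.exp (θ (s, t)) = β s - β t - w := fun s t => congrFun hθ (s, t)
  have hdiag : θ (0, 0) = θ (1, 1) := by
    refine Complex.isCoveringMap_exp.const_of_comp (g := fun t : ℝ => θ (t, t)) (by fun_prop)
      ?_ 0 1
    intro a a'
    apply Subtype.ext
    simp [hθ']
  have hc : Continuous (fun t : ℝ => (θ (t, 1) - θ (0, t)).im) := by fun_prop
  have key : ∀ t, (θ (t, 1) - θ (0, t)).im ≠ 0 := by
    intro t h0
    set X := θ (t, 1) - θ (0, t) with hX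
    have h1 : Complex.exp X * (β 0 - β t - w) = β t - β 1 - w := by
      rw [← hθ', ← hθ', ← Complex.exp_add, hX]; congr 1; ring
    have h2 : Complex.exp X = (Real.exp X.re : ℂ) := by
      have : X = (X.re : ℂ) := by apply Complex.ext <;> simp [h0]
      rw [this]; simp
    set u := β t - (β 0 + β 1) / 2 with hu
    set e := (β 0 - β 1) / 2 - w with he
    have h3 : (Real.exp X.re : ℂ) * (e - u) = u + e := by
      rw [← h2]
      have a1 : e - u = β 0 - β t - w := by rw [he, hu]; ring
      have a2 : u + e = β t - β 1 - w := by rw [he, hu]; ring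
      rw [a1, a2, h1]
    have hlt : ‖e‖ < ‖u‖ := hcon t
    set r := Real.exp X.re
    have hr : 0 < r := Real.exp_pos _
    have h4 : ((r : ℂ) - 1) * e = ((r : ℂ) + 1) * u := by linear_combination h3
    have h5 := congrArg norm h4
    rw [norm_mul, norm_mul] at h5
    have h6 : ‖(r : ℂ) + 1‖ = r + 1 := by
      rw [← Complex.ofReal_one, ← Complex.ofReal_add, Complex.norm_real, Real.norm_eq_abs,
        abs_of_pos (by linarith)]
    have h7 : ‖(r : ℂ) - 1‖ ≤ r + 1 := by
      rw [← Complex.ofReal_one, ← Complex.ofReal_sub, Complex.norm_real, Real.norm_eq_abs, abs_le]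
      constructor <;> linarith
    rw [h6] at h5
    nlinarith [norm_nonneg e, norm_nonneg u]
  have hneg : (θ (1, 1) - θ (0, 1)).im = - (θ (0, 1) - θ (0, 0)).im := by
    rw [hdiag]; simp
  obtain ⟨t, ht⟩ : ∃ t : ℝ, (θ (t, 1) - θ (0, t)).im = 0 := by
    have := mem_range_of_exists_le_of_exists_ge hc (c := 0)
      (by
        rcases le_total (θ (0, 1) - θ (0, 0)).im 0 with h | h
        · exact ⟨0, h⟩
        · exact ⟨1, by rw [hneg]; linarith⟩)
      (by
        rcases le_total (θ (0, 1) - θ (0, 0)).im 0 with h | h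
        · exact ⟨1, by rw [hneg]; linarith⟩
        · exact ⟨0, h⟩)
    exact this
  exact key t ht

theorem cross_lemma_R2 (β : ℝ → R2) (hβ : Continuous β) (w : R2)
    (hw : ∀ s t, β s - β t ≠ w) :
    ∃ t, ‖β t - (2⁻¹ : ℝ) • (β 0 + β 1)‖ ≤ ‖(2⁻¹ : ℝ) • (β 0 - β 1) - w‖ := by
  let L : R2 ≃ₗᵢ[ℝ] ℂ := Complex.orthonormalBasisOneI.repr.symm
  obtain ⟨t, ht⟩ := cross_lemma (fun s => L (β s)) (L.continuous.comp hβ) (L w) (by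
    intro s t h
    rw [← map_sub] at h
    exact hw s t (L.injective h))
  refine ⟨t, ?_⟩
  rw [← L.norm_map, ← L.norm_map ((2⁻¹ : ℝ) • (β 0 - β 1) - w)]
  have h2 : ∀ z : ℂ, (2⁻¹ : ℝ) • z = z / 2 := by
    intro z; rw [Complex.real_smul]; push_cast; ring
  simp only [map_sub, map_add, map_smul, h2]
  exact ht

theorem lattice_near (x : R2) : ∃ w ∈ intLattice, ‖x - w‖ ≤ 1 := by
  refine ⟨!₂[(round (x 0) : ℝ), (round (x 1) : ℝ)], ?_, ?_⟩
  · intro i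
    fin_cases i
    · exact ⟨round (x 0), rfl⟩
    · exact ⟨round (x 1), rfl⟩
  · rw [EuclideanSpace.norm_eq, Real.sqrt_le_iff, Fin.sum_univ_two]
    refine ⟨zero_le_one, ?_⟩
    have h0 := abs_sub_round (x 0)
    have h1 := abs_sub_round (x 1)
    have e0 : ‖(x - !₂[(round (x 0) : ℝ), (round (x 1) : ℝ)]) 0‖ = |x 0 - round (x 0)| := rfl
    have e1 : ‖(x - !₂[(round (x 0) : ℝ), (round (x 1) : ℝ)]) 1‖ = |x 1 - round (x 1)| := rfl
    rw [e0, e1]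
    have a0 := abs_nonneg (x 0 - round (x 0))
    have a1 := abs_nonneg (x 1 - round (x 1))
    nlinarith

theorem lattice_small (w : R2) (hw : w ∈ intLattice) (h : ‖w‖ < 1) : w = 0 := by
  ext i
  obtain ⟨n, hn⟩ := hw i
  have h1 : ‖w i‖ ≤ ‖w‖ := PiLp.norm_apply_le w i
  rw [hn, Real.norm_eq_abs, ← Int.cast_abs] at h1
  have h2 : ((|n| : ℤ) : ℝ) < 1 := lt_of_le_of_lt h1 h
  have h3 : |n| < 1 := by exact_mod_cast h2
  have h4 : n = 0 := Int.abs_lt_one_iff.1 h3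
  rw [hn, h4]; simp

theorem lattice_closed : IsClosed (intLattice : Set R2) := by
  have : (intLattice : Set R2) = ⋂ i : Fin 2, (fun v : R2 => v i) ⁻¹' (range ((↑) : ℤ → ℝ)) := by
    ext v
    simp only [SetLike.mem_coe, mem_iInter, mem_preimage, mem_range]
    constructor
    · intro h i
      obtain ⟨n, hn⟩ := h i
      exact ⟨n, hn.symm⟩
    · intro h i
      obtain ⟨n, hn⟩ := h i
      exact ⟨n, hn.symm⟩
  rw [this]
  refine isClosed_iInter fun i => IsClosed.preimage (by fun_prop) ?_
  exact Int.isClosedEmbedding_coe_real.isClosed_range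

def Equiv2 (H : R2 → R2) : Prop := ∀ x : R2, ∀ w ∈ intLattice, H (x + w) = H x + w

theorem disp_bdd (H : R2 → R2) (hc : Continuous H) (he : Equiv2 H) :
    ∃ M, 0 ≤ M ∧ ∀ x, ‖H x - x‖ ≤ M := by
  obtain ⟨M, hM⟩ := (isCompact_closedBall (0 : R2) 1).exists_bound_of_continuousOn
    (f := fun x => H x - x) (by fun_prop)
  refine ⟨M, (norm_nonneg _).trans (hM 0 (by simp)), fun x => ?_⟩
  obtain ⟨w, hw, hx⟩ := lattice_near x
  have := hM (x - w) (by simpa using hx)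
  have h2 := he (x - w) w hw
  rw [sub_add_cancel] at h2
  have e : H (x - w) + w - x = H (x - w) - (x - w) := by abel
  rw [h2, e]
  exact this

theorem midpoint_near (H : R2 → R2) (hc : Continuous H) (hi : Function.Injective H)
    (he : Equiv2 H) (x y : R2) :
    ∃ z, ‖(H z - z) - (2⁻¹ : ℝ) • ((H x - x) + (H y - y))‖ ≤ 4 := by
  wlog hxy : ‖x - y‖ ≤ 1 generalizing y
  · obtain ⟨w, hw, h⟩ := lattice_near (x - y)
    obtain ⟨z, hz⟩ := this (y + w) (by rwa [← sub_sub])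
    refine ⟨z, ?_⟩
    rw [he y w hw, add_sub_add_right_eq_sub] at hz
    exact hz
  let c : ℝ → ℝ := fun t => max 0 (min 1 t)
  have hcc : Continuous c := by fun_prop
  have hc0 : ∀ t, 0 ≤ c t := fun t => le_max_left _ _
  have hc1 : ∀ t, c t ≤ 1 := fun t => max_le zero_le_one (min_le_left _ _)
  let γ : ℝ → R2 := fun t => x + c t • (y - x)
  have hγ : Continuous γ := by fun_prop
  have hγ0 : γ 0 = x := by simp [γ, c]
  have hγ1 : γ 1 = y := by simp [γ, c]
  have hd : ∀ s t, ‖γ s - γ t‖ ≤ 1 := by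
    intro s t
    have : γ s - γ t = (c s - c t) • (y - x) := by simp only [γ]; module
    rw [this, norm_smul, norm_sub_rev y x, Real.norm_eq_abs]
    have : |c s - c t| ≤ 1 := by
      rw [abs_le]; constructor <;> linarith [hc0 s, hc0 t, hc1 s, hc1 t]
    nlinarith [norm_nonneg (x - y), abs_nonneg (c s - c t)]
  obtain ⟨w, hw, hwn⟩ := lattice_near ((2⁻¹ : ℝ) • (H x - H y))
  by_cases hcase : ∀ s t, H (γ s) - H (γ t) ≠ w
  · obtain ⟨t, ht⟩ := cross_lemma_R2 (fun t => H (γ t)) (hc.comp hγ) w hcase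
    refine ⟨γ t, ?_⟩
    simp only [hγ0, hγ1] at ht
    have e : (H (γ t) - γ t) - (2⁻¹ : ℝ) • ((H x - x) + (H y - y)) =
      (H (γ t) - (2⁻¹ : ℝ) • (H x + H y)) - (2⁻¹ : ℝ) • ((γ t - x) + (γ t - y)) := by module
    rw [e]
    refine (norm_sub_le _ _).trans ?_
    have h1 : ‖(2⁻¹ : ℝ) • ((γ t - x) + (γ t - y))‖ ≤ 1 := by
      rw [norm_smul]
      have := norm_add_le (γ t - x) (γ t - y)
      have a := hd t 0
      have b := hd t 1
      rw [hγ0] at a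
      rw [hγ1] at b
      norm_num
      linarith
    linarith
  · push Not at hcase
    obtain ⟨s, t, hst⟩ := hcase
    have h1 : H (γ s) = H (γ t + w) := by rw [he _ w hw, ← hst]; abel
    have h2 : γ s - γ t = w := by rw [hi h1]; abel
    have h3 : ‖w‖ ≤ 1 := h2 ▸ hd s t
    refine ⟨x, ?_⟩
    have e : (H x - x) - (2⁻¹ : ℝ) • ((H x - x) + (H y - y)) =
      ((2⁻¹ : ℝ) • (H x - H y) - w) + w - (2⁻¹ : ℝ) • (x - y) := by module
    rw [e]
    have h4 : ‖(2⁻¹ : ℝ) • (x - y)‖ ≤ 1 := by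
      rw [norm_smul]; norm_num; linarith
    refine (norm_sub_le _ _).trans ?_
    have := norm_add_le ((2⁻¹ : ℝ) • (H x - H y) - w) w
    linarith

theorem segment_near (E : Set R2) (M : ℝ) (hM : ∀ a ∈ E, ‖a‖ ≤ M)
    (hE : ∀ a ∈ E, ∀ b ∈ E, ∃ c ∈ E, ‖c - (2⁻¹ : ℝ) • (a + b)‖ ≤ 4) :
    ∀ a ∈ E, ∀ b ∈ E, ∀ t : ℝ, 0 ≤ t → t ≤ 1 → ∃ c ∈ E, ‖c - ((1 - t) • a + t • b)‖ ≤ 9 := by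
  have main : ∀ k : ℕ, ∀ a ∈ E, ∀ b ∈ E, ∀ t : ℝ, 0 ≤ t → t ≤ 1 →
      ∃ c ∈ E, ‖c - ((1 - t) • a + t • b)‖ ≤ 8 + (2 * M) / 2 ^ k := by
    intro k
    induction k with
    | zero =>
      intro a ha b hb t h0 h1
      refine ⟨a, ha, ?_⟩
      have e : a - ((1 - t) • a + t • b) = t • (a - b) := by module
      rw [e, norm_smul, Real.norm_eq_abs, abs_of_nonneg h0]
      have := norm_sub_le a b
      have := hM a ha
      have := hM b hb
      have := norm_nonneg (a - b)
      rw [pow_zero, div_one]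
      nlinarith
    | succ k ih =>
      have half : ∀ a ∈ E, ∀ b ∈ E, ∀ t : ℝ, 0 ≤ t → t ≤ 1 / 2 →
          ∃ c ∈ E, ‖c - ((1 - t) • a + t • b)‖ ≤ 8 + (2 * M) / 2 ^ (k + 1) := by
        intro a ha b hb t h0 h1
        obtain ⟨e, he, hen⟩ := ih a ha b hb (2 * t) (by linarith) (by linarith)
        obtain ⟨c, hc, hcn⟩ := hE a ha e he
        refine ⟨c, hc, ?_⟩
        have eq : c - ((1 - t) • a + t • b) = (c - (2⁻¹ : ℝ) • (a + e)) +
          (2⁻¹ : ℝ) • (e - ((1 - 2 * t) • a + (2 * t) • b)) := by module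
        rw [eq]
        refine (norm_add_le _ _).trans ?_
        rw [norm_smul]
        have : ‖(2⁻¹ : ℝ)‖ = 2⁻¹ := by norm_num
        rw [this, pow_succ]
        have : 2 * M / (2 ^ k * 2) = 2⁻¹ * (2 * M / 2 ^ k) := by field_simp
        rw [this]
        linarith
      intro a ha b hb t h0 h1
      rcases le_total t (1 / 2) with h | h
      · exact half a ha b hb t h0 h
      · obtain ⟨c, hc, hcn⟩ := half b hb a ha (1 - t) (by linarith) (by linarith)
        refine ⟨c, hc, ?_⟩
        convert hcn using 3
        module
  intro a ha b hb t h0 h1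
  obtain ⟨k, hk⟩ := pow_unbounded_of_one_lt (2 * M) (one_lt_two : (1 : ℝ) < 2)
  obtain ⟨c, hc, hcn⟩ := main k a ha b hb t h0 h1
  refine ⟨c, hc, hcn.trans ?_⟩
  have : 2 * M / 2 ^ k ≤ 1 := by
    rw [div_le_one (by positivity)]; exact hk.le
  linarith

theorem finset_near (E : Set R2)
    (hE : ∀ a ∈ E, ∀ b ∈ E, ∀ t : ℝ, 0 ≤ t → t ≤ 1 →
      ∃ c ∈ E, ‖c - ((1 - t) • a + t • b)‖ ≤ 9) (s : Finset R2) :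
    (s : Set R2) ⊆ E → ∀ z ∈ convexHull ℝ (s : Set R2), ∃ c ∈ E, ‖c - z‖ ≤ 9 * s.card := by
  classical
  induction s using Finset.induction_on with
  | empty => intro _ z hz; simp at hz
  | insert a s ha ih =>
    intro hs z hz
    have hsE : (s : Set R2) ⊆ E := fun x hx => hs (by simp [show x ∈ s from hx])
    have haE : a ∈ E := hs (by simp)
    rcases s.eq_empty_or_nonempty with rfl | hne
    · simp at hz
      exact ⟨a, haE, by simp [hz]⟩
    · rw [Finset.coe_insert, convexHull_insert (by simpa using hne), mem_convexJoin] at hz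
      obtain ⟨a', ha', y, hy, hz⟩ := hz
      rw [mem_singleton_iff] at ha'
      subst ha'
      obtain ⟨e, he, hen⟩ := ih hsE y hy
      obtain ⟨p, q, hp, hq, hpq, rfl⟩ := hz
      obtain ⟨c, hc, hcn⟩ := hE a' haE e he q hq (by linarith)
      refine ⟨c, hc, ?_⟩
      have hp' : p = 1 - q := by linarith
      subst hp'
      have eq : c - ((1 - q) • a' + q • y) = (c - ((1 - q) • a' + q • e)) + q • (e - y) := by
        module
      rw [eq, Finset.card_insert_of_notMem ha]
      refine (norm_add_le _ _).trans ?_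
      rw [norm_smul, Real.norm_eq_abs, abs_of_nonneg hq]
      push_cast
      have := norm_nonneg (e - y)
      nlinarith

theorem hull_near (H : R2 → R2) (hc : Continuous H) (hi : Function.Injective H)
    (he : Equiv2 H) (z : R2) (hz : z ∈ convexHull ℝ (range fun x => H x - x)) :
    ∃ x, ‖(H x - x) - z‖ ≤ 27 := by
  obtain ⟨M, -, hM⟩ := disp_bdd H hc he
  have hseg := segment_near (range fun x => H x - x) M (by rintro _ ⟨x, rfl⟩; exact hM x) (by
    rintro _ ⟨x, rfl⟩ _ ⟨y, rfl⟩
    obtain ⟨z, hz⟩ := midpoint_near H hc hi he x y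
    exact ⟨_, ⟨z, rfl⟩, hz⟩)
  rw [convexHull_eq_union] at hz
  simp only [mem_iUnion] at hz
  obtain ⟨t, hts, hind, hz⟩ := hz
  obtain ⟨_, ⟨x, rfl⟩, hx⟩ := finset_near _ hseg t hts z hz
  refine ⟨x, hx.trans ?_⟩
  have h1 := hind.card_le_finrank_succ
  have h2 : Module.finrank ℝ (vectorSpan ℝ (range ((↑) : t → R2))) ≤ 2 := by
    refine (Submodule.finrank_le _).trans ?_
    simp
  rw [Fintype.card_coe] at h1
  have h3 : t.card ≤ 3 := by omega
  have h4 : (t.card : ℝ) ≤ 3 := by exact_mod_cast h3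
  linarith

theorem smul_add_mem {C : Set R2} (hC : Convex ℝ C) {a b : ℝ} (ha : 0 ≤ a) (hb : 0 ≤ b)
    {u v : R2} (hu : u ∈ a • C) (hv : v ∈ b • C) : u + v ∈ (a + b) • C := by
  rw [hC.add_smul ha hb]
  exact add_mem_add hu hv

theorem blocks_mem {C : Set R2} (hC : Convex ℝ C) (hne : C.Nonempty) (K : R2 → R2)
    (hK : ∀ x, K x - x ∈ C) (z : R2) (q : ℕ) : K^[q] z - z ∈ (q : ℝ) • C := by
  induction q with
  | zero => simp [zero_smul_set hne]
  | succ q ih =>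
    rw [Function.iterate_succ_apply']
    have h1 : K (K^[q] z) - K^[q] z ∈ (1 : ℝ) • C := by
      rw [one_smul]; exact hK _
    have := smul_add_mem hC (Nat.cast_nonneg q) zero_le_one ih h1
    push_cast
    convert this using 1
    abel

theorem equiv2_iter {H : R2 → R2} (he : Equiv2 H) (n : ℕ) : Equiv2 H^[n] := by
  induction n with
  | zero => intro x w _; simp
  | succ n ih =>
    intro x w hw
    rw [Function.iterate_succ_apply', ih x w hw, he _ w hw, Function.iterate_succ_apply']

theorem disp_iter {H : R2 → R2} {M : ℝ} (hM : ∀ x, ‖H x - x‖ ≤ M) (n : ℕ) (x : R2) :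
    ‖H^[n] x - x‖ ≤ n * M := by
  induction n with
  | zero => simp
  | succ n ih =>
    rw [Function.iterate_succ_apply']
    have e : H (H^[n] x) - x = (H (H^[n] x) - H^[n] x) + (H^[n] x - x) := by abel
    rw [e]
    refine (norm_add_le _ _).trans ?_
    push_cast
    linarith [hM (H^[n] x)]

theorem rot_mem_closure (F : R2 ≃ₜ R2) (he : Equiv2 F) (a : R2) (ha : a ∈ rotSet F) (n : ℕ)
    (hn : 0 < n) :
    (n : ℝ) • a ∈ closure (convexHull ℝ (range fun x => F^[n] x - x)) := by
  obtain ⟨M, hM0, hM⟩ := disp_bdd F F.continuous he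
  obtain ⟨z, N, hN, hlim⟩ := ha
  have hn' : (0 : ℝ) < n := by exact_mod_cast hn
  rw [Metric.mem_closure_iff]
  intro δ hδ
  have h1 : Tendsto (fun k => (n : ℝ) • ((N k : ℝ)⁻¹ • (F^[N k] (z k) - z k))) atTop
      (𝓝 ((n : ℝ) • a)) := hlim.const_smul _
  have h2 : Tendsto (fun k => (2 * n * (n * M)) * ((N k : ℝ))⁻¹) atTop (𝓝 0) := by
    have := (tendsto_inv_atTop_zero.comp (tendsto_natCast_atTop_atTop.comp hN)).const_mul
      (2 * n * (n * M) : ℝ)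
    simpa using this
  have h3 := (Metric.tendsto_nhds.1 h1) (δ / 2) (by linarith)
  have h4 := (Metric.tendsto_nhds.1 h2) (δ / 2) (by linarith)
  obtain ⟨k, h3, h4, h5⟩ := (h3.and (h4.and (hN.eventually_ge_atTop n))).exists
  set C := convexHull ℝ (range fun x => F^[n] x - x) with hC
  have hCne : C.Nonempty := ⟨_, subset_convexHull ℝ _ ⟨0, rfl⟩⟩
  have hb := blocks_mem (convex_convexHull ℝ _) hCne F^[n]
    (fun x => subset_convexHull ℝ _ ⟨x, rfl⟩) (z k) (N k / n)
  obtain ⟨A, hA, hAeq⟩ := hb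
  refine ⟨A, hA, ?_⟩
  have hAn : ‖A‖ ≤ n * M := by
    have : C ⊆ closedBall 0 (n * M) := by
      refine convexHull_min ?_ (convex_closedBall _ _)
      rintro _ ⟨x, rfl⟩
      simpa using disp_iter hM n x
    simpa using this hA
  set X := F^[N k] (z k) - z k with hX
  set q := N k / n with hq
  set r := N k % n with hr
  have hrn : r < n := Nat.mod_lt _ hn
  have hNk : N k = n * q + r := (Nat.div_add_mod _ _).symm
  have hNr : (N k : ℝ) = n * q + r := by exact_mod_cast hNk
  have hNpos : (0 : ℝ) < N k := by exact_mod_cast (lt_of_lt_of_le hn h5)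
  simp only at hAeq
  rw [← Function.iterate_mul] at hAeq
  set R := X - (q : ℝ) • A with hR
  have hRn : ‖R‖ ≤ n * M := by
    have : R = F^[r] (F^[n * q] (z k)) - F^[n * q] (z k) := by
      rw [hR, hAeq, hX, ← Function.iterate_add_apply, hNk, add_comm r]
      abel
    rw [this]
    refine (disp_iter hM r _).trans ?_
    gcongr
  have eq : (n : ℝ) • ((N k : ℝ)⁻¹ • X) - A = ((n : ℝ) * (N k : ℝ)⁻¹) • (R - ((r : ℝ) / n) • A) := by
    have e1 : A = ((n : ℝ) * (N k : ℝ)⁻¹) • (((N k : ℝ) / n) • A) := by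
      rw [smul_smul]
      have : (n : ℝ) * (N k : ℝ)⁻¹ * ((N k : ℝ) / n) = 1 := by field_simp
      rw [this, one_smul]
    have e2 : (N k : ℝ) / n = q + r / n := by rw [hNr]; field_simp
    rw [e2] at e1
    conv_lhs => rw [e1]
    rw [hR]
    module
  have hno : ‖(n : ℝ) • ((N k : ℝ)⁻¹ • X) - A‖ ≤ (2 * n * (n * M)) * ((N k : ℝ))⁻¹ := by
    rw [eq, norm_smul, Real.norm_eq_abs, abs_of_nonneg (by positivity)]
    have h6 : ‖R - ((r : ℝ) / n) • A‖ ≤ 2 * (n * M) := by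
      refine (norm_sub_le _ _).trans ?_
      rw [norm_smul, Real.norm_eq_abs, abs_of_nonneg (by positivity)]
      have : (r : ℝ) / n ≤ 1 := by
        rw [div_le_one hn']; exact_mod_cast hrn.le
      nlinarith [norm_nonneg A]
    have : 0 ≤ (n : ℝ) * (N k : ℝ)⁻¹ := by positivity
    calc _ ≤ (n : ℝ) * (N k : ℝ)⁻¹ * (2 * (n * M)) := by gcongr
      _ = _ := by ring
  rw [Real.dist_eq, sub_zero] at h4
  have h4' := lt_of_le_of_lt (le_abs_self _) h4
  rw [dist_comm] at h3
  have := dist_triangle ((n : ℝ) • a) ((n : ℝ) • ((N k : ℝ)⁻¹ • X)) A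
  rw [dist_eq_norm ((n : ℝ) • ((N k : ℝ)⁻¹ • X)) A] at this
  linarith

theorem rot_convex (F : R2 ≃ₜ R2) (he : Equiv2 F) : Convex ℝ (rotSet F) := by
  intro a ha b hb s t hs ht hst
  have h : ∀ n : ℕ, ∃ x, ‖(F^[n + 1] x - x) - ((n + 1 : ℕ) : ℝ) • (s • a + t • b)‖ ≤ 28 := by
    intro n
    have hA := rot_mem_closure F he a ha (n + 1) n.succ_pos
    have hB := rot_mem_closure F he b hb (n + 1) n.succ_pos
    have hAB := (convex_convexHull ℝ (range fun x => F^[n + 1] x - x)).closure hA hB hs ht hst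
    rw [Metric.mem_closure_iff] at hAB
    obtain ⟨c, hc, hcn⟩ := hAB 1 one_pos
    obtain ⟨x, hx⟩ := hull_near F^[n + 1] (F.continuous.iterate _) (F.injective.iterate _)
      (equiv2_iter he _) c hc
    refine ⟨x, ?_⟩
    rw [dist_comm, dist_eq_norm] at hcn
    have e : (F^[n + 1] x - x) - ((n + 1 : ℕ) : ℝ) • (s • a + t • b) = ((F^[n + 1] x - x) - c) +
      (c - (s • ((n + 1 : ℕ) : ℝ) • a + t • ((n + 1 : ℕ) : ℝ) • b)) := by module
    rw [e]
    refine (norm_add_le _ _).trans ?_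
    linarith
  choose z hz using h
  refine ⟨z, fun n => n + 1, tendsto_add_atTop_nat 1, ?_⟩
  rw [tendsto_iff_norm_sub_tendsto_zero]
  have h0 : Tendsto (fun n : ℕ => (28 : ℝ) * ((n + 1 : ℕ) : ℝ)⁻¹) atTop (𝓝 0) := by
    have := ((tendsto_inv_atTop_zero.comp (tendsto_natCast_atTop_atTop (R := ℝ))).comp
      (tendsto_add_atTop_nat 1)).const_mul (28 : ℝ)
    simpa using this
  refine squeeze_zero (fun _ => norm_nonneg _) (fun n => ?_) h0
  have hp : (0 : ℝ) < ((n + 1 : ℕ) : ℝ) := by positivity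
  have e : ((n + 1 : ℕ) : ℝ)⁻¹ • (F^[n + 1] (z n) - z n) - (s • a + t • b) =
    ((n + 1 : ℕ) : ℝ)⁻¹ • ((F^[n + 1] (z n) - z n) - ((n + 1 : ℕ) : ℝ) • (s • a + t • b)) := by
    rw [smul_sub _ (F^[n + 1] (z n) - z n), smul_smul, inv_mul_cancel₀ hp.ne', one_smul]
  rw [e, norm_smul, Real.norm_eq_abs, abs_of_pos (by positivity), mul_comm]
  gcongr
  exact hz n

theorem osc_le (F : R2 ≃ₜ R2) (he : Equiv2 F) (x y : R2) :
    ‖(F x - x) - (F y - y)‖ ≤ osc F := by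
  obtain ⟨M, hM0, hM⟩ := disp_bdd F F.continuous he
  refine le_ciSup (f := fun p : R2 × R2 => ‖(F p.1 - p.1) - (F p.2 - p.2)‖) ?_ (x, y)
  refine ⟨M + M, ?_⟩
  rintro _ ⟨p, rfl⟩
  exact (norm_sub_le _ _).trans (add_le_add (hM _) (hM _))

theorem rot_near (F : R2 ≃ₜ R2) (he : Equiv2 F) (x : R2) :
    ∃ r ∈ rotSet F, ‖F x - x - r‖ ≤ osc F := by
  have h0 : 0 ≤ osc F := (norm_nonneg _).trans (osc_le F he x x)
  set C := closedBall (F x - x) (osc F)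
  have hb := blocks_mem (C := C) (convex_closedBall _ _) ⟨_, mem_closedBall_self h0⟩ F
    (fun y => by rw [mem_closedBall, dist_eq_norm]; exact osc_le F he y x) 0
  have hmem : ∀ n : ℕ, ((n + 1 : ℕ) : ℝ)⁻¹ • (F^[n + 1] 0 - 0) ∈ C := by
    intro n
    obtain ⟨A, hA, hAe⟩ := hb (n + 1)
    simp only at hAe
    rw [← hAe, smul_smul, inv_mul_cancel₀ (by positivity), one_smul]
    exact hA
  obtain ⟨r, hr, φ, hφ, hlim⟩ := (isCompact_closedBall (F x - x) (osc F)).tendsto_subseq hmem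
  refine ⟨r, ⟨fun _ => 0, fun k => φ k + 1, ?_, hlim⟩, ?_⟩
  · exact (tendsto_add_atTop_nat 1).comp hφ.tendsto_atTop
  · rw [mem_closedBall, dist_comm, dist_eq_norm] at hr
    exact hr

theorem bump_homeo (c u : R2) (r : ℝ) (hur : ‖u‖ < r) :
    ∃ h : R2 ≃ₜ R2, Equiv2 h ∧ h c = c + u ∧
      (∀ x, h x ≠ x → ∃ w ∈ intLattice, dist x (c + w) < r) ∧ ∀ x, ‖h x - x‖ ≤ ‖u‖ := by
  have hr : 0 < r := (norm_nonneg u).trans_lt hur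
  let A : Set R2 := {y | y - c ∈ intLattice}
  have hAc : c ∈ A := by simp [A, intLattice.zero_mem]
  let φ : R2 → ℝ := fun x => max 0 (1 - infDist x A / r)
  have hφ0 : ∀ x, 0 ≤ φ x := fun x => le_max_left _ _
  have hφ1 : ∀ x, φ x ≤ 1 := fun x => max_le zero_le_one (by
    have : 0 ≤ infDist x A / r := div_nonneg infDist_nonneg hr.le
    linarith)
  have hφc : φ c = 1 := by simp [φ, infDist_zero_of_mem hAc]
  have hper : ∀ x, ∀ w ∈ intLattice, infDist (x + w) A = infDist x A := by
    intro x w hw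
    have hle : ∀ x, ∀ w ∈ intLattice, infDist (x + w) A ≤ infDist x A := by
      intro x w hw
      rw [le_infDist ⟨c, hAc⟩]
      intro y hy
      have : y + w ∈ A := by
        change y + w - c ∈ intLattice
        have := intLattice.add_mem hy hw
        rwa [sub_add_eq_add_sub] at this
      have := infDist_le_dist_of_mem (x := x + w) this
      rwa [dist_add_right] at this
    refine le_antisymm (hle x w hw) ?_
    have := hle (x + w) (-w) (intLattice.neg_mem hw)
    rwa [add_neg_cancel_right] at this
  have hlip : ∀ x y, |φ x - φ y| ≤ r⁻¹ * ‖x - y‖ := by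
    intro x y
    have h1 := abs_max_sub_max_le_abs (1 - infDist x A / r) (1 - infDist y A / r) 0
    rw [max_comm _ (0 : ℝ), max_comm _ (0 : ℝ)] at h1
    refine h1.trans ?_
    have e : 1 - infDist x A / r - (1 - infDist y A / r) = r⁻¹ * (infDist y A - infDist x A) := by
      field_simp
      ring
    rw [e, abs_mul, abs_of_pos (by positivity : 0 < r⁻¹)]
    gcongr
    have a := infDist_le_infDist_add_dist (s := A) (x := x) (y := y)
    have b := infDist_le_infDist_add_dist (s := A) (x := y) (y := x)
    rw [dist_comm] at b
    rw [dist_eq_norm] at a b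
    rw [abs_le]
    constructor <;> linarith
  let g : R2 → R2 := fun x => x + φ x • u
  have happ : ApproximatesLinearOn g ((ContinuousLinearEquiv.refl ℝ R2 : R2 ≃L[ℝ] R2) : R2 →L[ℝ] R2)
      univ (‖u‖₊ / r.toNNReal) := by
    intro x _ y _
    have e : g x - g y - ((ContinuousLinearEquiv.refl ℝ R2 : R2 ≃L[ℝ] R2) : R2 →L[ℝ] R2) (x - y)
      = (φ x - φ y) • u := by
      simp only [g, ContinuousLinearEquiv.coe_coe, ContinuousLinearEquiv.refl_apply]; module
    rw [e, norm_smul, Real.norm_eq_abs]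
    push_cast
    rw [Real.coe_toNNReal _ hr.le]
    calc _ ≤ r⁻¹ * ‖x - y‖ * ‖u‖ := by gcongr; exact hlip x y
      _ = _ := by field_simp
  have hc1 : Subsingleton R2 ∨ ‖u‖₊ / r.toNNReal <
      ‖((ContinuousLinearEquiv.refl ℝ R2).symm : R2 →L[ℝ] R2)‖₊⁻¹ := by
    right
    have e : ‖((ContinuousLinearEquiv.refl ℝ R2).symm : R2 →L[ℝ] R2)‖₊ = 1 := by
      apply NNReal.eq
      simp
    rw [e, inv_one, div_lt_one (by simpa using hr), ← NNReal.coe_lt_coe, Real.coe_toNNReal _ hr.le]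
    exact hur
  refine ⟨happ.toHomeomorph g hc1, ?_, ?_, ?_, ?_⟩
  · intro x w hw
    change x + w + φ (x + w) • u = x + φ x • u + w
    have : φ (x + w) = φ x := by simp only [φ, hper x w hw]
    rw [this]; abel
  · change c + φ c • u = c + u
    rw [hφc, one_smul]
  · intro x hx
    change x + φ x • u ≠ x at hx
    have h1 : φ x ≠ 0 := by rintro h; simp [h] at hx
    have h2 : infDist x A < r := by
      by_contra! h
      apply h1
      have : 1 ≤ infDist x A / r := by rwa [one_le_div hr]
      exact max_eq_left (by linarith)
    rw [infDist_lt_iff ⟨c, hAc⟩] at h2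
    obtain ⟨y, hy, hd⟩ := h2
    exact ⟨y - c, hy, by simpa using hd⟩
  · intro x
    change ‖x + φ x • u - x‖ ≤ _
    rw [add_sub_cancel_left, norm_smul, Real.norm_eq_abs, abs_of_nonneg (hφ0 x)]
    nlinarith [norm_nonneg u, hφ1 x]

structure GoodH (V : Set R2) (h : R2 ≃ₜ R2) : Prop where
  eqv : Equiv2 h
  fix : ∀ x, (∀ w ∈ intLattice, x - w ∉ V) → h x = x
  inv : ∀ x ∈ V, h x ∈ V

theorem GoodH.inv' {V : Set R2} {h : R2 ≃ₜ R2} (H : GoodH V h) (x w : R2) (hw : w ∈ intLattice)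
    (hx : x - w ∈ V) : h x - w ∈ V := by
  have := H.inv _ hx
  have e := H.eqv x (-w) (intLattice.neg_mem hw)
  rw [← sub_eq_add_neg, ← sub_eq_add_neg] at e
  rwa [e] at this

theorem GoodH.trans {V : Set R2} {h k : R2 ≃ₜ R2} (H : GoodH V h) (K : GoodH V k) :
    GoodH V (h.trans k) where
  eqv := by
    intro x w hw
    simp only [Homeomorph.trans_apply]
    rw [H.eqv x w hw, K.eqv _ w hw]
  fix := by
    intro x hx
    simp only [Homeomorph.trans_apply]
    rw [H.fix x hx, K.fix x hx]
  inv := fun x hx => K.inv _ (H.inv x hx)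

theorem thick_dist (p q : R2) (δ : ℝ) (x y : R2) (hx : x ∈ thickening δ (segment ℝ p q))
    (hy : y ∈ thickening δ (segment ℝ p q)) : ‖x - y‖ < ‖p - q‖ + 2 * δ := by
  rw [mem_thickening_iff] at hx hy
  obtain ⟨a, ha, hxa⟩ := hx
  obtain ⟨b, hb, hyb⟩ := hy
  rw [segment_eq_image'] at ha hb
  obtain ⟨s, ⟨hs0, hs1⟩, rfl⟩ := ha
  obtain ⟨t, ⟨ht0, ht1⟩, rfl⟩ := hb
  rw [dist_eq_norm] at hxa hyb
  simp only at hxa hyb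
  have e : x - y = (x - (p + s • (q - p))) - (y - (p + t • (q - p))) + (s - t) • (q - p) := by
    module
  have h1 : ‖(s - t) • (q - p)‖ ≤ ‖p - q‖ := by
    rw [norm_smul, norm_sub_rev q p, Real.norm_eq_abs]
    have : |s - t| ≤ 1 := by rw [abs_le]; constructor <;> linarith
    nlinarith [norm_nonneg (p - q)]
  rw [e]
  refine (norm_add_le _ _).trans_lt ?_
  have := norm_sub_le (x - (p + s • (q - p))) (y - (p + t • (q - p)))
  linarith

theorem push_exists (p q : R2) (δ κ : ℝ) (hδ : 0 < δ) (hκ : ‖p - q‖ + 2 * δ ≤ κ) (hκ1 : κ < 1) :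
    ∃ h : R2 ≃ₜ R2, GoodH (thickening δ (segment ℝ p q)) h ∧ h p = q := by
  set V := thickening δ (segment ℝ p q) with hV
  have hdist : ∀ x ∈ V, ∀ y ∈ V, ‖x - y‖ < κ := by
    intro x hx y hy
    exact (thick_dist p q δ x y hx hy).trans_le hκ
  have step : ∀ c ∈ segment ℝ p q, ∀ u : R2, ‖u‖ < δ / 2 → ∃ h : R2 ≃ₜ R2, GoodH V h ∧ h c = c + u := by
    intro c hc u hu
    obtain ⟨h, he, hcu, hsupp, hno⟩ := bump_homeo c u (δ / 2) hu
    refine ⟨h, ⟨he, ?_, ?_⟩, hcu⟩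
    · intro x hx
      by_contra hne
      obtain ⟨w, hw, hd⟩ := hsupp x hne
      refine hx w hw ?_
      rw [hV, mem_thickening_iff]
      refine ⟨c, hc, ?_⟩
      rw [dist_eq_norm] at hd ⊢
      have e : x - w - c = x - (c + w) := by abel
      rw [e]; linarith
    · intro x hx
      by_cases hne : h x = x
      · rwa [hne]
      obtain ⟨w, hw, hd⟩ := hsupp x hne
      rw [dist_eq_norm] at hd
      have e : x - w - c = x - (c + w) := by abel
      have hxw : x - w ∈ V := by
        rw [hV, mem_thickening_iff]
        refine ⟨c, hc, ?_⟩
        rw [dist_eq_norm, e]; linarith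
      have hw0 : w = 0 := by
        apply lattice_small w hw
        have := hdist x hx _ hxw
        rw [sub_sub_cancel] at this
        linarith
      subst hw0
      rw [hV, mem_thickening_iff]
      refine ⟨c, hc, ?_⟩
      rw [dist_eq_norm]
      have e2 : h x - c = (h x - x) + (x - (c + 0)) := by rw [add_zero]; abel
      rw [e2]
      refine (norm_add_le _ _).trans_lt ?_
      linarith [hno x]
  obtain ⟨m, hm⟩ := exists_nat_gt (‖q - p‖ / (δ / 2))
  have hm0 : (0 : ℝ) < m := lt_of_le_of_lt (by positivity) hm
  have hsmall : ‖(m : ℝ)⁻¹ • (q - p)‖ < δ / 2 := by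
    rw [norm_smul, norm_inv, Real.norm_natCast, inv_mul_lt_iff₀ hm0]
    rwa [div_lt_iff₀ (by linarith)] at hm
  have main : ∀ k : ℕ, k ≤ m → ∃ h : R2 ≃ₜ R2, GoodH V h ∧ h p = p + ((k : ℝ) / m) • (q - p) := by
    intro k
    induction k with
    | zero =>
      intro _
      exact ⟨Homeomorph.refl _, ⟨fun _ _ _ => rfl, fun _ _ => rfl, fun _ h => h⟩, by simp⟩
    | succ k ih =>
      intro hk
      obtain ⟨h, hg, hp⟩ := ih (by omega)
      have hseg : p + ((k : ℝ) / m) • (q - p) ∈ segment ℝ p q := by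
        rw [segment_eq_image']
        refine ⟨(k : ℝ) / m, ⟨by positivity, ?_⟩, rfl⟩
        rw [div_le_one hm0]
        exact_mod_cast (by omega : k ≤ m)
      obtain ⟨h', hg', hp'⟩ := step _ hseg _ hsmall
      refine ⟨h.trans h', hg.trans hg', ?_⟩
      rw [Homeomorph.trans_apply, hp, hp', add_assoc, ← add_smul]
      congr 2
      push_cast
      field_simp
  obtain ⟨h, hg, hp⟩ := main m le_rfl
  refine ⟨h, hg, ?_⟩
  rw [hp, div_self hm0.ne', one_smul]
  abel

theorem pr_eq_iff (x y : R2) : pr x = pr y ↔ -x + y ∈ intLattice := QuotientAddGroup.eq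

theorem equiv2_symm (G : R2 ≃ₜ R2) (h : Equiv2 G) : Equiv2 G.symm := by
  intro x w hw
  apply G.injective
  rw [h _ w hw, G.apply_symm_apply, G.apply_symm_apply]

theorem equiv2_pr {G : R2 → R2} (h : Equiv2 G) (x y : R2) (hxy : pr x = pr y) :
    pr (G x) = pr (G y) := by
  rw [pr_eq_iff] at hxy
  have := h x _ hxy
  rw [add_neg_cancel_left] at this
  rw [pr_eq_iff, this]
  simpa using hxy

def descend (G : R2 → R2) (h : Equiv2 G) : T2 → T2 :=
  Quotient.lift (fun x => pr (G x)) (fun x y hxy => equiv2_pr h x y (Quotient.sound hxy))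

theorem descend_pr (G : R2 → R2) (h : Equiv2 G) (x : R2) : descend G h (pr x) = pr (G x) := rfl

theorem descend_cont (G : R2 → R2) (h : Equiv2 G) (hc : Continuous G) :
    Continuous (descend G h) := by
  have : Continuous pr := continuous_quot_mk
  exact (this.comp hc).quotient_lift _

theorem exists_descent (G : R2 ≃ₜ R2) (h : Equiv2 G) : ∃ g : T2 ≃ₜ T2, IsLift g G := by
  have hs := equiv2_symm G h
  refine ⟨⟨⟨descend G h, descend G.symm hs, ?_, ?_⟩, descend_cont _ h G.continuous,
    descend_cont _ hs G.symm.continuous⟩, ⟨fun x => rfl, h⟩⟩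
  · intro y
    obtain ⟨x, rfl⟩ : ∃ x, pr x = y := QuotientAddGroup.mk_surjective y
    rw [descend_pr, descend_pr, G.symm_apply_apply]
  · intro y
    obtain ⟨x, rfl⟩ : ∃ x, pr x = y := QuotientAddGroup.mk_surjective y
    rw [descend_pr, descend_pr, G.apply_symm_apply]

theorem periodic_rot (G : R2 ≃ₜ R2) (he : Equiv2 G) (y v : R2) (l : ℕ) (hl : 0 < l)
    (hv : v ∈ intLattice) (h : G^[l] y = y + v) : (l : ℝ)⁻¹ • v ∈ rotSet G := by
  have hk : ∀ k : ℕ, G^[l * k] y = y + (k : ℝ) • v := by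
    intro k
    induction k with
    | zero => simp
    | succ k ih =>
      have hkv : (k : ℝ) • v ∈ intLattice := by
        rw [Nat.cast_smul_eq_nsmul]; exact intLattice.nsmul_mem hv k
      rw [mul_add, mul_one, add_comm, Function.iterate_add_apply, ih,
        equiv2_iter he l y _ hkv, h]
      push_cast
      module
  refine ⟨fun _ => y, fun k => l * (k + 1), ?_, ?_⟩
  · refine tendsto_atTop_mono (fun k => ?_) tendsto_id
    simp only [id]
    nlinarith
  · refine tendsto_const_nhds.congr (fun k => ?_)
    rw [hk, add_sub_cancel_left, smul_smul]
    congr 1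
    push_cast
    have : (l : ℝ) ≠ 0 := by positivity
    field_simp

theorem loop_mem (F : R2 ≃ₜ R2) (he : Equiv2 F) (ε : ℝ) (hε1 : ε < 1)
    (hstab : UpperStable Homeo0 F ε) (l : ℕ) :
    ∀ y v : R2, v ∈ intLattice → ‖F^[l] y - (y + v)‖ < ε → v ∈ (l : ℝ) • rotSet F := by
  have hne : (rotSet F).Nonempty := by
    obtain ⟨r, hr, -⟩ := rot_near F he 0
    exact ⟨r, hr⟩
  induction l using Nat.strong_induction_on with
  | _ l ih =>
  intro y v hv hy
  rcases Nat.eq_zero_or_pos l with rfl | hl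
  · have : v = 0 := by
      apply lattice_small v hv
      simp at hy
      linarith
    rw [this]
    simp [zero_smul_set hne]
  by_cases hsplit : ∃ k, 0 < k ∧ k < l ∧ ∃ w ∈ intLattice,
      F^[k] y + w ∈ segment ℝ (F^[l] y) (y + v)
  · obtain ⟨k, hk0, hkl, w, hw, hseg⟩ := hsplit
    have hseg' := hseg
    rw [segment_eq_image'] at hseg'
    obtain ⟨t, ⟨ht0, ht1⟩, hte⟩ := hseg'
    simp only at hte
    have h1 := ih k hkl y (v - w) (intLattice.sub_mem hv hw) (by
      have e : F^[k] y - (y + (v - w)) = (1 - t) • (F^[l] y - (y + v)) := by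
        have : F^[k] y = F^[l] y + t • (y + v - F^[l] y) - w := by rw [hte]; abel
        rw [this]; module
      rw [e, norm_smul, Real.norm_eq_abs, abs_of_nonneg (by linarith)]
      nlinarith [norm_nonneg (F^[l] y - (y + v))])
    have h2 := ih (l - k) (by omega) (F^[k] y) w hw (by
      rw [← Function.iterate_add_apply, Nat.sub_add_cancel hkl.le]
      have e : F^[l] y - (F^[k] y + w) = t • (F^[l] y - (y + v)) := by
        rw [← hte]; module
      rw [e, norm_smul, Real.norm_eq_abs, abs_of_nonneg ht0]
      nlinarith [norm_nonneg (F^[l] y - (y + v))])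
    have := smul_add_mem (rot_convex F he) (Nat.cast_nonneg k) (Nat.cast_nonneg (l - k)) h1 h2
    rw [sub_add_cancel, ← Nat.cast_add, Nat.add_sub_cancel' hkl.le] at this
    exact this
  · push Not at hsplit
    set p := F^[l] y with hp
    set q := y + v with hq
    let B : Set R2 := ⋃ k ∈ Finset.Ioo 0 l, {x | x - F^[k] y ∈ intLattice}
    have hB : IsClosed B := by
      refine isClosed_biUnion_finset fun k _ => ?_
      exact lattice_closed.preimage (by fun_prop : Continuous fun x : R2 => x - F^[k] y)
    have hsB : segment ℝ p q ⊆ Bᶜ := by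
      intro x hx hxB
      simp only [B, mem_iUnion, Finset.mem_Ioo] at hxB
      obtain ⟨k, ⟨hk0, hkl⟩, hxk⟩ := hxB
      refine hsplit k hk0 hkl _ hxk ?_
      rwa [add_sub_cancel]
    have hcomp : IsCompact (segment ℝ p q) := by
      rw [segment_eq_image']
      exact isCompact_Icc.image (by fun_prop)
    obtain ⟨δ₀, hδ₀, hsub⟩ := hcomp.exists_thickening_subset_open hB.isOpen_compl hsB
    set δ := min δ₀ ((ε - ‖p - q‖) / 4) with hδ
    have hδ0 : 0 < δ := lt_min hδ₀ (by linarith)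
    have hδ1 : δ ≤ (ε - ‖p - q‖) / 4 := min_le_right _ _
    have hsub' : thickening δ (segment ℝ p q) ⊆ Bᶜ :=
      (thickening_mono (min_le_left _ _) _).trans hsub
    set κ := ‖p - q‖ + 2 * δ with hκ
    obtain ⟨h, hg, hpq⟩ := push_exists p q δ κ hδ0 le_rfl (by linarith)
    set G := F.trans h with hG
    have hGe : Equiv2 G := by
      intro x w hw
      simp only [hG, Homeomorph.trans_apply]
      rw [he x w hw, hg.eqv _ w hw]
    have hclose : ∀ x, dist (F x) (G x) ≤ κ := by
      intro x
      simp only [hG, Homeomorph.trans_apply]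
      by_cases hx : ∀ w ∈ intLattice, F x - w ∉ thickening δ (segment ℝ p q)
      · rw [hg.fix _ hx, dist_self]
        positivity
      · push Not at hx
        obtain ⟨w, hw, hx⟩ := hx
        have := thick_dist p q δ _ _ hx (hg.inv' _ w hw hx)
        rw [sub_sub_sub_cancel_right] at this
        rw [dist_eq_norm]
        exact this.le
    have hsup : supDist F G < ε := by
      refine lt_of_le_of_lt (ciSup_le hclose) (by linarith)
    obtain ⟨g, hgl⟩ := exists_descent G hGe
    have hrot := hstab g ⟨G, hgl⟩ G hgl hsup
    have hiter : ∀ i, i < l → G^[i] y = F^[i] y := by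
      intro i
      induction i with
      | zero => intro _; rfl
      | succ i ihi =>
        intro hi
        rw [Function.iterate_succ_apply', ihi (by omega), Function.iterate_succ_apply']
        simp only [hG, Homeomorph.trans_apply]
        refine hg.fix _ ?_
        intro w hw hmem
        refine hsub' hmem ?_
        simp only [B, mem_iUnion, Finset.mem_Ioo]
        refine ⟨i + 1, ⟨by omega, hi⟩, ?_⟩
        rw [Function.iterate_succ_apply']
        change _ ∈ intLattice
        have e : F (F^[i] y) - w - F (F^[i] y) = -w := by abel
        rw [e]
        exact intLattice.neg_mem hw
    have hfin : G^[l] y = y + v := by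
      obtain ⟨m, rfl⟩ : ∃ m, l = m + 1 := ⟨l - 1, by omega⟩
      rw [Function.iterate_succ_apply', hiter m (by omega)]
      simp only [hG, Homeomorph.trans_apply]
      rw [← Function.iterate_succ_apply' (⇑F), ← hp, hpq]
    have := hrot (periodic_rot G hGe y v l hl hv hfin)
    refine ⟨_, this, ?_⟩
    have hl' : (l : ℝ) ≠ 0 := by positivity
    simp only
    rw [smul_smul, mul_inv_cancel₀ hl', one_smul]

def SepMod (ε : ℝ) (a b : R2) : Prop := ∀ w ∈ intLattice, ε ≤ ‖a - b - w‖

theorem SepMod.symm {ε : ℝ} {a b : R2} (h : SepMod ε a b) : SepMod ε b a := by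
  intro w hw
  have := h (-w) (intLattice.neg_mem hw)
  rwa [← norm_neg, show -(a - b - -w) = b - a - w by abel] at this

theorem packing (ε : ℝ) (hε0 : 0 < ε) (hε1 : ε < 1) (l : List R2) (hl : l.Pairwise (SepMod ε)) :
    (l.length : ℝ) ≤ 4 / (Real.pi * ε ^ 2) := by
  by_contra! hcon
  have hpi := Real.pi_pos
  let y : Fin l.length → R2 := fun i => l.get i
  have hsep : ∀ i j, i ≠ j → SepMod ε (y i) (y j) := by
    intro i j hij
    rw [List.pairwise_iff_get] at hl
    rcases lt_or_gt_of_ne hij with h | h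
    · exact hl i j h
    · exact (hl j i h).symm
  let s : Set R2 := ⋃ i, ball (y i) (ε / 2)
  let b := (EuclideanSpace.basisFun (Fin 2) ℝ)
  have hfund := ZSpan.isAddFundamentalDomain' b.toBasis (volume : Measure R2)
  have hvol : volume (ZSpan.fundamentalDomain b.toBasis) = 1 := by
    rw [measure_congr (ZSpan.fundamentalDomain_ae_parallelepiped b.toBasis volume)]
    have := b.volume_parallelepiped
    simpa using this
  have hs : volume s = l.length * (ENNReal.ofReal (ε / 2) ^ 2 * ENNReal.ofReal Real.pi) := by
    rw [measure_iUnion]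
    · simp [tsum_fintype]
    · intro i j hij
      refine ball_disjoint_ball ?_
      have := hsep i j hij 0 intLattice.zero_mem
      rw [sub_zero] at this
      rw [dist_eq_norm]; linarith
    · exact fun i => measurableSet_ball
  have hlt : volume (ZSpan.fundamentalDomain b.toBasis) < volume s := by
    rw [hvol, hs, ← ENNReal.ofReal_natCast, ← ENNReal.ofReal_pow (by positivity),
      ← ENNReal.ofReal_mul (by positivity), ← ENNReal.ofReal_mul (by positivity),
      ENNReal.one_lt_ofReal]
    rw [div_lt_iff₀ (by positivity)] at hcon
    nlinarith
  have : Countable (Submodule.span ℤ (range b.toBasis)).toAddSubgroup :=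
    inferInstanceAs (Countable (Submodule.span ℤ (range b.toBasis)))
  obtain ⟨u, v, huv, hnd⟩ := exists_pair_mem_lattice_not_disjoint_vadd hfund
    (MeasurableSet.iUnion fun i => measurableSet_ball).nullMeasurableSet hlt
  have hlat : ∀ u : (Submodule.span ℤ (range b.toBasis)).toAddSubgroup, (u : R2) ∈ intLattice := by
    intro u i
    have := (b.toBasis.mem_span_iff_repr_mem ℤ (u : R2)).1 u.2 i
    obtain ⟨n, hn⟩ := this
    refine ⟨n, ?_⟩
    simpa [b] using hn.symm
  rw [Set.not_disjoint_iff] at hnd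
  obtain ⟨z, hz1, hz2⟩ := hnd
  obtain ⟨a, ha, hza⟩ := hz1
  obtain ⟨c, hc, hzc⟩ := hz2
  simp only [mem_iUnion, mem_ball] at ha hc
  obtain ⟨i, hi⟩ := ha
  obtain ⟨j, hj⟩ := hc
  have hza' : (u : R2) + a = z := hza
  have hzc' : (v : R2) + c = z := hzc
  rw [dist_eq_norm] at hi hj
  have hw : (v : R2) - u ∈ intLattice := intLattice.sub_mem (hlat v) (hlat u)
  have hnorm : ‖y i - y j - ((v : R2) - u)‖ < ε := by
    have e : y i - y j - ((v : R2) - u) = (c - y j) - (a - y i) := by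
      have : a = z - u := by rw [← hza']; abel
      have h' : c = z - v := by rw [← hzc']; abel
      rw [this, h']; abel
    rw [e]
    refine (norm_sub_le _ _).trans_lt ?_
    linarith
  by_cases hij : i = j
  · subst hij
    have h0 : (v : R2) - u = 0 := by
      apply lattice_small _ hw
      rw [sub_self, zero_sub, norm_neg] at hnorm
      linarith
    exact huv (Subtype.ext (sub_eq_zero.1 h0).symm)
  · exact absurd (hsep i j hij _ hw) (not_le.2 hnorm)

theorem decomp (F : R2 ≃ₜ R2) (he : Equiv2 F) (ε : ℝ) (hε0 : 0 < ε) (hε1 : ε < 1)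
    (hstab : UpperStable Homeo0 F ε) (n : ℕ) :
    ∀ x : R2, ∃ l : List R2, l.Pairwise (SepMod ε) ∧ (∀ y ∈ l, ∃ i ≤ n, y = F^[i] x) ∧
      ∃ r ∈ (n : ℝ) • rotSet F, ‖F^[n] x - x - r‖ ≤ l.length * (osc F + 1) := by
  classical
  induction n using Nat.strong_induction_on with
  | _ n ih =>
  intro x
  have ho : 0 ≤ osc F := (norm_nonneg _).trans (osc_le F he x x)
  let P : ℕ → Prop := fun j => ¬ SepMod ε x (F^[j] x)
  have hP0 : P 0 := by
    intro h
    have := h 0 intLattice.zero_mem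
    simp at this
    linarith
  set j := Nat.findGreatest P n with hj
  have hjn : j ≤ n := Nat.findGreatest_le n
  have hPj : P j := Nat.findGreatest_spec (Nat.zero_le n) hP0
  have hgt : ∀ k, j < k → k ≤ n → SepMod ε x (F^[k] x) := by
    intro k hk hkn
    have := Nat.findGreatest_is_greatest hk hkn
    exact not_not.1 this
  have hPj' := hPj
  simp only [P, SepMod] at hPj'
  push Not at hPj'
  obtain ⟨w, hw, hwn⟩ := hPj'
  have hloop : -w ∈ (j : ℝ) • rotSet F := by
    refine loop_mem F he ε hε1 hstab j x (-w) (intLattice.neg_mem hw) ?_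
    rwa [← norm_neg, show -(F^[j] x - (x + -w)) = x - F^[j] x - w by abel]
  have hd : ‖F^[j] x - x - (-w)‖ ≤ 1 := by
    rw [← norm_neg, show -(F^[j] x - x - (-w)) = x - F^[j] x - w by abel]
    linarith
  rcases hjn.eq_or_lt with hjn' | hjn'
  · refine ⟨[x], by simp, by simpa using ⟨0, Nat.zero_le n, rfl⟩, -w, ?_, ?_⟩
    · rwa [← hjn']
    · rw [← hjn']
      simp only [List.length_singleton, Nat.cast_one]
      linarith
  · set x' := F^[j + 1] x with hx'
    obtain ⟨l, hl, hlm, r, hr, hrn⟩ := ih (n - (j + 1)) (by omega) x'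
    obtain ⟨r1, hr1, hr1n⟩ := rot_near F he (F^[j] x)
    refine ⟨x :: l, ?_, ?_, -w + r1 + r, ?_, ?_⟩
    · rw [List.pairwise_cons]
      refine ⟨fun y hy => ?_, hl⟩
      obtain ⟨i, hi, rfl⟩ := hlm y hy
      rw [hx', ← Function.iterate_add_apply]
      exact hgt _ (by omega) (by omega)
    · intro y hy
      rw [List.mem_cons] at hy
      rcases hy with rfl | hy
      · exact ⟨0, Nat.zero_le n, rfl⟩
      · obtain ⟨i, hi, rfl⟩ := hlm y hy
        exact ⟨i + (j + 1), by omega, by rw [hx', ← Function.iterate_add_apply]⟩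
    · have h1 : r1 ∈ (1 : ℝ) • rotSet F := by rwa [one_smul]
      have hc := rot_convex F he
      have := smul_add_mem hc (by positivity) (Nat.cast_nonneg (n - (j + 1)))
        (smul_add_mem hc (Nat.cast_nonneg j) zero_le_one hloop h1) hr
      have e : (j : ℝ) + 1 + ((n - (j + 1) : ℕ) : ℝ) = n := by
        have : j + 1 + (n - (j + 1)) = n := by omega
        exact_mod_cast this
      rwa [e] at this
    · have e1 : F^[n] x = F^[n - (j + 1)] x' := by
        rw [hx', ← Function.iterate_add_apply]; congr 2; omega
      have e2 : x' = F (F^[j] x) := by rw [hx', Function.iterate_succ_apply']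
      have e : F^[n] x - x - (-w + r1 + r) = (F^[n - (j + 1)] x' - x' - r) +
          (F (F^[j] x) - F^[j] x - r1) + (F^[j] x - x - (-w)) := by
        rw [e1, ← e2]; abel
      rw [e]
      refine (norm_add₃_le).trans ?_
      simp only [List.length_cons]
      push_cast
      linarith

/-- If `f ∈ Homeo₀(T²)` has an `ε`-upper-stable rotation set with
`0 < ε < 1` and `F` is a lift of `f`, then for every `x̃ ∈ ℝ²` and every `n ∈ ℕ`,
`d(Fⁿ(x̃) − x̃, n·ρ(F)) ≤ (4/(πε²))·(osc(f) + 1) + ε`. -/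
theorem orbit_deviation_bound_of_upper_stable (f : T2 ≃ₜ T2) (hf : f ∈ Homeo0)
    (ε : ℝ) (hε0 : 0 < ε) (hε1 : ε < 1)
    (F : R2 ≃ₜ R2) (hF : IsLift f F) (hstab : UpperStable Homeo0 F ε) :
    ∀ x : R2, ∀ n : ℕ,
      Metric.infDist ((⇑F)^[n] x - x) ((n : ℝ) • rotSet F) ≤
        (4 / (Real.pi * ε ^ 2)) * (osc (⇑F) + 1) + ε := by
  intro x n
  have he : Equiv2 F := hF.equivariant
  have ho : 0 ≤ osc F := (norm_nonneg _).trans (osc_le F he x x)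
  obtain ⟨l, hl, -, r, hr, hrn⟩ := decomp F he ε hε0 hε1 hstab n x
  have hp := packing ε hε0 hε1 l hl
  refine (infDist_le_dist_of_mem hr).trans ?_
  rw [dist_eq_norm]
  refine hrn.trans ?_
  have : (l.length : ℝ) * (osc F + 1) ≤ 4 / (Real.pi * ε ^ 2) * (osc F + 1) := by gcongr
  linarith
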